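/- Two root lattices L(Σ₁) and L(Σ₂) of type ADE are isomorphic as lattices if and only if the root types Σ₁ and Σ₂ are equal. -/

import Mathlib

open Matrix

/-- A symbol of `ADE` type: `Aₗ`, `Dₘ`, `E₆`, `E₇` or `E₈`. -/
inductive ADE : Type
  | A (l : ℕ) | D (m : ℕ) | E6 | E7 | E8

/-- The symbol is admissible: `l ≥ 1` for `Aₗ` and `m ≥ 4` for `Dₘ`. -/
def ADE.ok : ADE → Prop
  | .A l => 1 ≤ l
  | .D m => 4 ≤ m
  | _ => True

/-- The rank of the root lattice of an `ADE` symbol. -/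
def ADE.rank : ADE → ℕ
  | .A l => l | .D m => m | .E6 => 6 | .E7 => 7 | .E8 => 8

/-- The Cartan matrix of type `Aₙ` (vertices `0, …, n-1` in a chain). -/
def cartanA (n : ℕ) : Matrix (Fin n) (Fin n) ℤ := fun i j =>
  if i = j then 2 else if (i : ℕ) + 1 = j ∨ (j : ℕ) + 1 = i then -1 else 0

/-- The Cartan matrix of type `Dₙ` (a chain `0 — 1 — ⋯ — (n-2)` together with the
extra vertex `n-1` attached to the vertex `n-3`). -/
def cartanD (n : ℕ) : Matrix (Fin n) (Fin n) ℤ := fun i j =>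
  if i = j then 2
  else if (((i : ℕ) + 1 = j ∨ (j : ℕ) + 1 = i) ∧ (i : ℕ) + 1 ≠ n ∧ (j : ℕ) + 1 ≠ n) ∨
      ((i : ℕ) + 3 = n ∧ (j : ℕ) + 1 = n) ∨ ((j : ℕ) + 3 = n ∧ (i : ℕ) + 1 = n) then -1
  else 0

/-- The Gram matrix of the *negative definite* root lattice of an `ADE` symbol
(the negated Cartan matrix). -/
def ADE.gram : (t : ADE) → Matrix (Fin t.rank) (Fin t.rank) ℤ
  | .A l => -cartanA l
  | .D m => -cartanD m
  | .E6 => -CartanMatrix.E₆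
  | .E7 => -CartanMatrix.E₇
  | .E8 => -CartanMatrix.E₈

/-- The Gram matrix of the negative definite root lattice `L(Σ)` of a root type,
the root type being presented as a list of `ADE` symbols. -/
def bigGram (L : List ADE) :
    Matrix (Σ i : Fin L.length, Fin (L.get i).rank) (Σ i : Fin L.length, Fin (L.get i).rank) ℤ :=
  Matrix.blockDiagonal' fun i => (L.get i).gram


/-- A symmetric positive definite integral matrix with `2` on the diagonal whose graph of nonzero
entries is connected. -/
structure IsRootGram {n : Type} [Fintype n] (G : Matrix n n ℤ) : Prop where
  symm : ∀ a b, G a b = G b a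
  diag : ∀ a, G a a = 2
  pos : ∀ x : n → ℤ, x ≠ 0 → 0 < x ⬝ᵥ G *ᵥ x
  conn : ∀ {α : Type} (f : n → α), (∀ a b, G a b ≠ 0 → f a = f b) → ∀ a b, f a = f b

namespace IsRootGram

variable {n : Type} [Fintype n] {G : Matrix n n ℤ}

theorem two_dvd (hG : IsRootGram G) (x : n → ℤ) : 2 ∣ x ⬝ᵥ G *ᵥ x := by
  classical
  have hT : Gᵀ = G := by ext a b; exact hG.symm b a
  have hadd : ∀ y z : n → ℤ, 2 ∣ y ⬝ᵥ G *ᵥ y → 2 ∣ z ⬝ᵥ G *ᵥ z →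
      2 ∣ (y + z) ⬝ᵥ G *ᵥ (y + z) := by
    intro y z hy hz
    have hc : z ⬝ᵥ G *ᵥ y = y ⬝ᵥ G *ᵥ z := by
      rw [dotProduct_mulVec, dotProduct_comm, ← mulVec_transpose, hT]
    simp only [mulVec_add, dotProduct_add, add_dotProduct, hc]
    omega
  have hx : x = ∑ a, Pi.single a (x a) := (Finset.univ_sum_single x).symm
  rw [hx]
  refine Finset.sum_induction _ (fun y : n → ℤ => 2 ∣ y ⬝ᵥ G *ᵥ y) hadd (by simp) fun a _ => ?_
  simp [hG.diag]
  exact ⟨x a * x a, by ring⟩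

theorem two_le (hG : IsRootGram G) {x : n → ℤ} (hx : x ≠ 0) :
    2 ≤ x ⬝ᵥ G *ᵥ x := by
  have h₁ := hG.two_dvd x
  have h₂ := hG.pos x hx
  omega

theorem nonneg (hG : IsRootGram G) (x : n → ℤ) : 0 ≤ x ⬝ᵥ G *ᵥ x := by
  by_cases hx : x = 0
  · simp [hx]
  · exact (hG.pos x hx).le

end IsRootGram

section Blocks

variable {ι κ : Type} {m : ι → Type} {n : κ → Type}

/-- The vector `x` is supported in the block with index `i`. -/
def SupportedIn (x : (Σ i, m i) → ℤ) (i : ι) : Prop := ∀ k, k ≠ i → ∀ a, x ⟨k, a⟩ = 0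

theorem SupportedIn.add {x y : (Σ i, m i) → ℤ} {i : ι} (hx : SupportedIn x i)
    (hy : SupportedIn y i) : SupportedIn (x + y) i := fun k hk a => by
  simp [hx k hk a, hy k hk a]

theorem SupportedIn.smul {x : (Σ i, m i) → ℤ} {i : ι} (c : ℤ) (hx : SupportedIn x i) :
    SupportedIn (c • x) i := fun k hk a => by simp [hx k hk a]

theorem supportedIn_zero (i : ι) : SupportedIn (0 : (Σ i, m i) → ℤ) i := fun _ _ _ => rfl

theorem SupportedIn.single [DecidableEq (Σ i, m i)] (i : ι) (a : m i) :
    SupportedIn (Pi.single (⟨i, a⟩ : Σ i, m i) (1 : ℤ)) i := fun k hk b => by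
  rw [Pi.single_apply, if_neg]
  intro h
  exact hk (congrArg Sigma.fst h)

theorem supportedIn_unique {x : (Σ i, m i) → ℤ} {i j : ι} (hx : x ≠ 0) (hi : SupportedIn x i)
    (hj : SupportedIn x j) : i = j := by
  by_contra hij
  refine hx (funext fun ⟨k, a⟩ => ?_)
  by_cases hk : k = i
  · exact hj k (hk ▸ hij) a
  · exact hi k hk a

/-- The inclusion of a block. -/
noncomputable abbrev blockIncl (m : ι → Type) (i : ι) : (m i → ℤ) →ₗ[ℤ] ((Σ i, m i) → ℤ) :=
  Function.ExtendByZero.linearMap ℤ (Sigma.mk i)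

theorem blockIncl_apply (i : ι) (x : m i → ℤ) (a : m i) : blockIncl m i x ⟨i, a⟩ = x a :=
  sigma_mk_injective.extend_apply x 0 a

theorem supportedIn_blockIncl (i : ι) (x : m i → ℤ) : SupportedIn (blockIncl m i x) i :=
  fun _ hk _ => Function.extend_apply' _ _ _ fun ⟨_, hb⟩ => hk (congrArg Sigma.fst hb).symm

theorem SupportedIn.blockIncl_eq {x : (Σ i, m i) → ℤ} {i : ι} (hx : SupportedIn x i) :
    blockIncl m i (fun a => x ⟨i, a⟩) = x := by
  funext ⟨k, a⟩
  by_cases hk : k = i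
  · subst hk
    exact blockIncl_apply k _ a
  · rw [hx k hk a, supportedIn_blockIncl i _ k hk a]

variable [Fintype ι] [DecidableEq ι] [Fintype κ] [DecidableEq κ] [∀ i, Fintype (m i)]
  [∀ j, Fintype (n j)]

theorem dotProduct_blockDiagonal'_mulVec (G : ∀ i, Matrix (m i) (m i) ℤ)
    (x y : (Σ i, m i) → ℤ) :
    x ⬝ᵥ blockDiagonal' G *ᵥ y =
      ∑ i, (fun a => x ⟨i, a⟩) ⬝ᵥ G i *ᵥ (fun a => y ⟨i, a⟩) := by
  simp only [dotProduct, mulVec, Fintype.sum_sigma]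
  refine Finset.sum_congr rfl fun i _ => Finset.sum_congr rfl fun a _ => ?_
  congr 1
  rw [Finset.sum_eq_single i]
  · simp
  · intro k _ hk
    simp [blockDiagonal'_apply_ne _ _ _ hk.symm]
  · simp

theorem SupportedIn.dotProduct_eq {G : ∀ i, Matrix (m i) (m i) ℤ} {x : (Σ i, m i) → ℤ} {i : ι}
    (hx : SupportedIn x i) (y : (Σ i, m i) → ℤ) :
    x ⬝ᵥ blockDiagonal' G *ᵥ y = (fun a => x ⟨i, a⟩) ⬝ᵥ G i *ᵥ (fun a => y ⟨i, a⟩) := by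
  rw [dotProduct_blockDiagonal'_mulVec]
  refine Finset.sum_eq_single i (fun k _ hk => ?_) (by simp)
  have : (fun a => x ⟨k, a⟩) = 0 := funext (hx k hk)
  rw [this, zero_dotProduct]

theorem SupportedIn.dotProduct_eq_zero {G : ∀ i, Matrix (m i) (m i) ℤ} {x y : (Σ i, m i) → ℤ}
    {i j : ι} (hx : SupportedIn x i) (hy : SupportedIn y j) (hij : i ≠ j) :
    x ⬝ᵥ blockDiagonal' G *ᵥ y = 0 := by
  rw [hx.dotProduct_eq]
  have : (fun a => y ⟨i, a⟩) = 0 := funext (hy i hij)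
  rw [this, mulVec_zero, dotProduct_zero]

/-- A vector of norm `2` lies in a single block. -/
theorem exists_supportedIn {G : ∀ i, Matrix (m i) (m i) ℤ} (hG : ∀ i, IsRootGram (G i))
    {x : (Σ i, m i) → ℤ} (hx : x ⬝ᵥ blockDiagonal' G *ᵥ x = 2) : ∃ i, SupportedIn x i := by
  have hx0 : x ≠ 0 := by rintro rfl; simp at hx
  obtain ⟨⟨i, a⟩, ha⟩ := Function.ne_iff.mp hx0
  have hi : (fun a => x ⟨i, a⟩) ≠ 0 := fun h => ha (congrFun h a)
  refine ⟨i, fun k hk b => ?_⟩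
  by_contra hb
  have hk' : (fun a => x ⟨k, a⟩) ≠ 0 := fun h => hb (congrFun h b)
  rw [dotProduct_blockDiagonal'_mulVec] at hx
  have hle := Finset.sum_le_univ_sum_of_nonneg (s := {i, k})
    (fun j => (hG j).nonneg (fun a => x ⟨j, a⟩))
  rw [Finset.sum_pair hk.symm, hx] at hle
  have h₁ := (hG i).two_le hi
  have h₂ := (hG k).two_le hk'
  omega

/-- An isometry maps every block into a block. -/
theorem exists_block_map [∀ i, Nonempty (m i)] {G : ∀ i, Matrix (m i) (m i) ℤ}
    {H : ∀ j, Matrix (n j) (n j) ℤ} (hG : ∀ i, IsRootGram (G i)) (hH : ∀ j, IsRootGram (H j))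
    (e : ((Σ i, m i) → ℤ) →ₗ[ℤ] ((Σ j, n j) → ℤ))
    (he : ∀ x y, e x ⬝ᵥ blockDiagonal' H *ᵥ e y = x ⬝ᵥ blockDiagonal' G *ᵥ y) :
    ∃ f : ι → κ, ∀ i x, SupportedIn x i → SupportedIn (e x) (f i) := by
  classical
  have hs : ∀ i (a b : m i), (Pi.single (⟨i, a⟩ : Σ i, m i) (1 : ℤ)) ⬝ᵥ blockDiagonal' G *ᵥ
      (Pi.single (⟨i, b⟩ : Σ i, m i) (1 : ℤ)) = G i a b := by
    intro i a b
    simp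
  have hroot : ∀ (i : ι) (a : m i), ∃ j, SupportedIn (e (Pi.single ⟨i, a⟩ 1)) j := fun i a =>
    exists_supportedIn hH (by rw [he, hs, (hG i).diag])
  choose φ hφ using hroot
  have hconst : ∀ i a b, φ i a = φ i b := fun i => (hG i).conn (φ i) fun a b hab => by
    by_contra hne
    exact hab (by rw [← hs, ← he, (hφ i a).dotProduct_eq_zero (hφ i b) hne])
  refine ⟨fun i => φ i (Classical.arbitrary _), fun i x hx => ?_⟩
  have hsum : x = ∑ p, x p • Pi.single p (1 : ℤ) := by
    simpa [← Pi.single_smul] using (Finset.univ_sum_single x).symm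
  rw [hsum, map_sum]
  refine Finset.sum_induction _ (fun y => SupportedIn y _) (fun _ _ => SupportedIn.add)
    (supportedIn_zero _) fun p _ => ?_
  obtain ⟨k, a⟩ := p
  rw [map_smul]
  by_cases hk : k = i
  · subst hk
    refine SupportedIn.smul _ ?_
    beta_reduce
    rw [hconst k (Classical.arbitrary _) a]
    exact hφ k a
  · rw [hx k hk a, zero_smul]
    exact supportedIn_zero _

/-- An isometry between orthogonal sums of irreducible root lattices matches up the summands. -/
theorem exists_block_equiv [∀ i, Nonempty (m i)] [∀ j, Nonempty (n j)]
    {G : ∀ i, Matrix (m i) (m i) ℤ} {H : ∀ j, Matrix (n j) (n j) ℤ}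
    (hG : ∀ i, IsRootGram (G i)) (hH : ∀ j, IsRootGram (H j))
    (e : ((Σ i, m i) → ℤ) ≃ₗ[ℤ] ((Σ j, n j) → ℤ))
    (he : ∀ x y, e x ⬝ᵥ blockDiagonal' H *ᵥ e y = x ⬝ᵥ blockDiagonal' G *ᵥ y) :
    ∃ σ : ι ≃ κ, ∀ i, ∃ e' : (m i → ℤ) ≃ₗ[ℤ] (n (σ i) → ℤ),
      ∀ x y, e' x ⬝ᵥ H (σ i) *ᵥ e' y = x ⬝ᵥ G i *ᵥ y := by
  classical
  obtain ⟨f, hf⟩ := exists_block_map hG hH e.toLinearMap he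
  obtain ⟨g, hg⟩ := exists_block_map hH hG e.symm.toLinearMap fun x y => by
    rw [← he]; simp
  have hgf : ∀ i, g (f i) = i := fun i => by
    obtain ⟨a⟩ := ‹∀ i, Nonempty (m i)› i
    have h := hg _ _ (hf i _ (SupportedIn.single i a))
    simp only [LinearEquiv.coe_coe, LinearEquiv.symm_apply_apply] at h
    exact supportedIn_unique (by simp) h (SupportedIn.single i a)
  have hfg : ∀ j, f (g j) = j := fun j => by
    obtain ⟨a⟩ := ‹∀ j, Nonempty (n j)› j
    have h := hf _ _ (hg j _ (SupportedIn.single j a))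
    simp only [LinearEquiv.coe_coe, LinearEquiv.apply_symm_apply] at h
    exact supportedIn_unique (by simp) h (SupportedIn.single j a)
  refine ⟨⟨f, g, hgf, hfg⟩, fun i => ?_⟩
  change ∃ e' : (m i → ℤ) ≃ₗ[ℤ] (n (f i) → ℤ), ∀ x y, e' x ⬝ᵥ H (f i) *ᵥ e' y = x ⬝ᵥ G i *ᵥ y
  have hsupp : ∀ x, SupportedIn (e (blockIncl m i x)) (f i) := fun x =>
    hf i _ (supportedIn_blockIncl i x)
  have hsupp' : ∀ y, SupportedIn (e.symm (blockIncl n (f i) y)) i := fun y => by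
    simpa [hgf] using hg (f i) _ (supportedIn_blockIncl (f i) y)
  refine ⟨LinearEquiv.ofLinearMap
    (LinearMap.funLeft ℤ ℤ (Sigma.mk (f i)) ∘ₗ e.toLinearMap ∘ₗ blockIncl m i)
    (LinearMap.funLeft ℤ ℤ (Sigma.mk i) ∘ₗ e.symm.toLinearMap ∘ₗ blockIncl n (f i))
    (LinearMap.ext fun y => ?_) (LinearMap.ext fun x => ?_), fun x y => ?_⟩
  · funext b
    change e (blockIncl m i fun a => e.symm (blockIncl n (f i) y) ⟨i, a⟩) ⟨f i, b⟩ = y b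
    rw [(hsupp' y).blockIncl_eq, e.apply_symm_apply, blockIncl_apply]
  · funext a
    change e.symm (blockIncl n (f i) fun b => e (blockIncl m i x) ⟨f i, b⟩) ⟨i, a⟩ = x a
    rw [(hsupp x).blockIncl_eq, e.symm_apply_apply, blockIncl_apply]
  · change (fun b => e (blockIncl m i x) ⟨f i, b⟩) ⬝ᵥ
      H (f i) *ᵥ (fun b => e (blockIncl m i y) ⟨f i, b⟩) = _
    rw [← (hsupp x).dotProduct_eq, he, (supportedIn_blockIncl i x).dotProduct_eq]
    simp only [blockIncl_apply]

end Blocks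

theorem natAbs_det_eq_of_isometry {m n : Type} [Fintype m] [Fintype n] [DecidableEq m]
    [DecidableEq n] {G : Matrix m m ℤ} {H : Matrix n n ℤ} (e : (m → ℤ) ≃ₗ[ℤ] (n → ℤ))
    (he : ∀ x y, e x ⬝ᵥ H *ᵥ e y = x ⬝ᵥ G *ᵥ y) : G.det.natAbs = H.det.natAbs := by
  set P := LinearMap.toMatrix' e.toLinearMap with hP
  set Q := LinearMap.toMatrix' e.symm.toLinearMap with hQ
  have hPQ : P * Q = 1 := by rw [hP, hQ, ← LinearMap.toMatrix'_comp]; simp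
  have hQP : Q * P = 1 := by rw [hP, hQ, ← LinearMap.toMatrix'_comp]; simp
  have hPmul : ∀ x, e x = P *ᵥ x := fun x => by
    rw [hP, LinearMap.toMatrix'_mulVec]; rfl
  have hG : G = Pᵀ * (H * P) := by
    ext a b
    have h := he (Pi.single a 1) (Pi.single b 1)
    have hGab : Pi.single a 1 ⬝ᵥ G *ᵥ Pi.single b 1 = G a b := by simp
    rw [hPmul, hPmul, mulVec_mulVec, mulVec_single_one, mulVec_single_one, hGab] at h
    exact h.symm
  have hPQt : Pᵀ * Qᵀ = 1 := by rw [← transpose_mul, hQP, transpose_one]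
  have hQPt : Qᵀ * Pᵀ = 1 := by rw [← transpose_mul, hPQ, transpose_one]
  have hunit : IsUnit (P * Pᵀ).det := by
    refine IsUnit.of_mul_eq_one (Qᵀ * Q).det ?_
    rw [← det_mul, Matrix.mul_assoc, ← Matrix.mul_assoc Pᵀ, hPQt, Matrix.one_mul, hPQ, det_one]
  rw [hG, det_comm' hPQt hQPt, Matrix.mul_assoc, det_mul, Int.natAbs_mul,
    Int.isUnit_iff_natAbs_eq.mp hunit, mul_one]

/-- The index `0` is a leaf, attached to the index `1`, of the graph of nonzero entries of `M`. -/
structure IsLeaf {n : ℕ} (M : Matrix (Fin (n + 2)) (Fin (n + 2)) ℤ) : Prop where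
  diag : M 0 0 = 2
  right : M 0 1 = -1
  left : M 1 0 = -1
  right_zero : ∀ j : Fin n, M 0 j.succ.succ = 0
  left_zero : ∀ j : Fin n, M j.succ.succ 0 = 0

namespace IsLeaf

variable {n : ℕ} {M : Matrix (Fin (n + 2)) (Fin (n + 2)) ℤ}

theorem det_eq (h : IsLeaf M) : M.det = 2 * (M.submatrix Fin.succ Fin.succ).det -
    ((M.submatrix Fin.succ Fin.succ).submatrix Fin.succ Fin.succ).det := by
  have hminor : (M.submatrix Fin.succ (Fin.succAbove 1)).det =
      -((M.submatrix Fin.succ Fin.succ).submatrix Fin.succ Fin.succ).det := by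
    rw [det_succ_column_zero, Fin.sum_univ_succ]
    have h0 : (1 : Fin (n + 2)).succAbove 0 = 0 := rfl
    have hs : ∀ j : Fin n, (1 : Fin (n + 2)).succAbove j.succ = j.succ.succ := fun j => by
      rw [← Fin.succ_zero_eq_one, Fin.succ_succAbove_succ, Fin.zero_succAbove]
    simp only [submatrix_apply, h0, h.left_zero, Fin.succ_zero_eq_one, h.left]
    simp [submatrix_submatrix, Function.comp_def, hs]
  rw [det_succ_row_zero, Fin.sum_univ_succ, Fin.sum_univ_succ]
  simp only [Fin.succ_zero_eq_one, h.right_zero, h.diag, h.right, hminor]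
  simp
  rfl

theorem quadratic_eq (h : IsLeaf M) (x : Fin (n + 2) → ℤ) :
    x ⬝ᵥ M *ᵥ x = 2 * x 0 ^ 2 - 2 * x 0 * x 1 +
      (fun i => x i.succ) ⬝ᵥ M.submatrix Fin.succ Fin.succ *ᵥ (fun i => x i.succ) := by
  have h₁ : ∑ j, M 0 (Fin.succ j) * x j.succ = - x 1 := by
    rw [Fin.sum_univ_succ]; simp [h.right_zero, h.right]
  have h₂ : ∑ i, x (Fin.succ i) * (M i.succ 0 * x 0) = - x 1 * x 0 := by
    rw [Fin.sum_univ_succ]; simp [h.left_zero, h.left]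
  simp only [dotProduct, mulVec]
  rw [Fin.sum_univ_succ]
  simp only [Fin.sum_univ_succ (fun j => M _ j * x j), h₁, h.diag, mul_add,
    Finset.sum_add_distrib, h₂, submatrix_apply]
  ring

theorem sq_le (h : IsLeaf M)
    (hM : ∀ x : Fin (n + 1) → ℤ, x 0 ^ 2 ≤ x ⬝ᵥ M.submatrix Fin.succ Fin.succ *ᵥ x)
    (x : Fin (n + 2) → ℤ) : x 0 ^ 2 ≤ x ⬝ᵥ M *ᵥ x := by
  rw [h.quadratic_eq]
  have := hM fun i => x i.succ
  rw [Fin.succ_zero_eq_one] at this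
  nlinarith [sq_nonneg (x 0 - x 1)]

theorem eq_zero (h : IsLeaf M)
    (hM : ∀ x : Fin (n + 1) → ℤ, x 0 ^ 2 ≤ x ⬝ᵥ M.submatrix Fin.succ Fin.succ *ᵥ x)
    (hM0 : ∀ x : Fin (n + 1) → ℤ, x ⬝ᵥ M.submatrix Fin.succ Fin.succ *ᵥ x = 0 → x = 0)
    (x : Fin (n + 2) → ℤ) (hx : x ⬝ᵥ M *ᵥ x = 0) : x = 0 := by
  have h0 : x 0 = 0 := by
    have := h.sq_le hM x
    exact pow_eq_zero_iff two_ne_zero |>.mp (le_antisymm (by omega) (sq_nonneg _))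
  rw [h.quadratic_eq, h0] at hx
  have ht := hM0 (fun i => x i.succ) (by simpa using hx)
  funext i
  refine Fin.cases h0 (fun j => congrFun ht j) i

end IsLeaf

theorem cartanA_submatrix_succ (n : ℕ) :
    (cartanA (n + 1)).submatrix Fin.succ Fin.succ = cartanA n := by
  ext i j
  simp [cartanA]

theorem isLeaf_cartanA (n : ℕ) : IsLeaf (cartanA (n + 2)) := by
  constructor <;> simp [cartanA, Fin.ext_iff]

theorem det_cartanA (n : ℕ) : (cartanA n).det = n + 1 := by
  induction n using Nat.twoStepInduction with
  | zero => simp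
  | one => simp [cartanA]
  | more n h₁ h₂ =>
    rw [(isLeaf_cartanA n).det_eq, cartanA_submatrix_succ, cartanA_submatrix_succ, h₁, h₂]
    push_cast
    ring

theorem cartanA_pos (n : ℕ) :
    (∀ x, x 0 ^ 2 ≤ x ⬝ᵥ cartanA (n + 1) *ᵥ x) ∧
      ∀ x, x ⬝ᵥ cartanA (n + 1) *ᵥ x = 0 → x = 0 := by
  induction n with
  | zero =>
    have h : ∀ x : Fin 1 → ℤ, x ⬝ᵥ cartanA 1 *ᵥ x = 2 * x 0 ^ 2 := fun x => by
      simp [cartanA, dotProduct, mulVec]; ring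
    refine ⟨fun x => ?_, fun x hx => ?_⟩
    · have := h x
      nlinarith [sq_nonneg (x 0)]
    · have := h x
      funext i
      rw [Fin.fin_one_eq_zero i]
      simpa [hx] using this
  | succ n ih =>
    have hl := isLeaf_cartanA n
    rw [← cartanA_submatrix_succ] at ih
    exact ⟨hl.sq_le ih.1, hl.eq_zero ih.1 ih.2⟩

theorem isRootGram_cartanA (n : ℕ) : IsRootGram (cartanA (n + 1)) where
  symm a b := by simp only [cartanA]; grind
  diag a := by simp [cartanA]
  pos x hx := lt_of_le_of_ne ((sq_nonneg _).trans ((cartanA_pos n).1 x))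
    fun h => hx ((cartanA_pos n).2 x h.symm)
  conn f hf := by
    have h : ∀ k (hk : k < n + 1), f ⟨k, hk⟩ = f 0 := by
      intro k
      induction k with
      | zero => intro _; rfl
      | succ k ih =>
        intro hk
        rw [← ih (by omega)]
        exact hf _ _ (by simp [cartanA])
    intro a b
    rw [h a a.2, h b b.2]

theorem cartanD_submatrix_succ (n : ℕ) :
    (cartanD (n + 3)).submatrix Fin.succ Fin.succ = cartanD (n + 2) := by
  ext i j
  simp only [cartanD, submatrix_apply, Fin.ext_iff, Fin.val_succ]
  grind

theorem isLeaf_cartanD (n : ℕ) : IsLeaf (cartanD (n + 4)) := by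
  constructor <;> intros <;>
    simp only [cartanD, Fin.ext_iff, Fin.val_succ, Fin.val_zero, Fin.val_one] <;> grind

theorem det_cartanD (n : ℕ) : (cartanD (n + 2)).det = 4 := by
  induction n using Nat.twoStepInduction with
  | zero => decide
  | one => decide
  | more n h₁ h₂ =>
    rw [(isLeaf_cartanD n).det_eq, cartanD_submatrix_succ, cartanD_submatrix_succ, h₁, h₂]
    norm_num

theorem cartanD_pos (n : ℕ) :
    (∀ x, x 0 ^ 2 ≤ x ⬝ᵥ cartanD (n + 3) *ᵥ x) ∧
      ∀ x, x ⬝ᵥ cartanD (n + 3) *ᵥ x = 0 → x = 0 := by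
  induction n with
  | zero =>
    have h : ∀ x : Fin 3 → ℤ, 2 * (x ⬝ᵥ cartanD 3 *ᵥ x) =
        2 * x 0 ^ 2 + (x 0 - 2 * x 1) ^ 2 + (x 0 - 2 * x 2) ^ 2 := fun x => by
      simp [cartanD, dotProduct, mulVec, Fin.sum_univ_succ]; ring
    refine ⟨fun x => ?_, fun x hx => ?_⟩
    · have := h x
      nlinarith [sq_nonneg (x 0 - 2 * x 1), sq_nonneg (x 0 - 2 * x 2)]
    · have := h x
      have h0 : x 0 = 0 := by
        nlinarith [sq_nonneg (x 0), sq_nonneg (x 0 - 2 * x 1), sq_nonneg (x 0 - 2 * x 2)]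
      have h1 : x 1 = 0 := by
        rw [hx, h0] at this
        nlinarith [sq_nonneg (x 1), sq_nonneg (x 2)]
      have h2 : x 2 = 0 := by
        rw [hx, h0] at this
        nlinarith [sq_nonneg (x 1), sq_nonneg (x 2)]
      funext i
      fin_cases i <;> assumption
  | succ n ih =>
    have hl := isLeaf_cartanD n
    rw [← cartanD_submatrix_succ] at ih
    exact ⟨hl.sq_le ih.1, hl.eq_zero ih.1 ih.2⟩

theorem isRootGram_cartanD (n : ℕ) : IsRootGram (cartanD (n + 3)) where
  symm a b := by simp only [cartanD]; grind
  diag a := by simp [cartanD]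
  pos x hx := lt_of_le_of_ne ((sq_nonneg _).trans ((cartanD_pos n).1 x))
    fun h => hx ((cartanD_pos n).2 x h.symm)
  conn f hf := by
    have h : ∀ k (hk : k < n + 2), f ⟨k, by omega⟩ = f 0 := by
      intro k
      induction k with
      | zero => intro _; rfl
      | succ k ih =>
        intro hk
        rw [← ih (by omega)]
        exact hf _ _ (by simp [cartanD]; omega)
    have h' : ∀ a, f a = f 0 := fun a => by
      by_cases ha : (a : ℕ) < n + 2
      · exact h a ha
      · rw [← h n (by omega)]
        exact hf _ _ (by simp [cartanD, Fin.ext_iff]; omega)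
    intro a b
    rw [h' a, h' b]

/-- The quadratic form of `E₈` is anisotropic and nonnegative. -/
theorem eq_zero_of_quadratic_E8_nonpos {a b c d e f g h : ℤ}
    (hq : a ^ 2 + b ^ 2 + c ^ 2 + d ^ 2 + e ^ 2 + f ^ 2 + g ^ 2 + h ^ 2
      - a * c - b * d - c * d - d * e - e * f - f * g - g * h ≤ 0) :
    a = 0 ∧ b = 0 ∧ c = 0 ∧ d = 0 ∧ e = 0 ∧ f = 0 ∧ g = 0 ∧ h = 0 := by
  have key : 30 * (2 * a - c) ^ 2 + 10 * (3 * c - 2 * d) ^ 2 + 30 * (2 * b - d) ^ 2 +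
      30 * (2 * h - g) ^ 2 + 10 * (3 * g - 2 * f) ^ 2 + 5 * (4 * f - 3 * e) ^ 2 +
      3 * (5 * e - 4 * d) ^ 2 + 2 * d ^ 2 ≤ 0 := by linarith
  have h₁ := sq_nonneg (2 * a - c)
  have h₂ := sq_nonneg (3 * c - 2 * d)
  have h₃ := sq_nonneg (2 * b - d)
  have h₄ := sq_nonneg (2 * h - g)
  have h₅ := sq_nonneg (3 * g - 2 * f)
  have h₆ := sq_nonneg (4 * f - 3 * e)
  have h₇ := sq_nonneg (5 * e - 4 * d)
  have h₈ := sq_nonneg d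
  have k₁ : 2 * a - c = 0 := pow_eq_zero_iff two_ne_zero |>.mp (by linarith)
  have k₂ : 3 * c - 2 * d = 0 := pow_eq_zero_iff two_ne_zero |>.mp (by linarith)
  have k₃ : 2 * b - d = 0 := pow_eq_zero_iff two_ne_zero |>.mp (by linarith)
  have k₄ : 2 * h - g = 0 := pow_eq_zero_iff two_ne_zero |>.mp (by linarith)
  have k₅ : 3 * g - 2 * f = 0 := pow_eq_zero_iff two_ne_zero |>.mp (by linarith)
  have k₆ : 4 * f - 3 * e = 0 := pow_eq_zero_iff two_ne_zero |>.mp (by linarith)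
  have k₇ : 5 * e - 4 * d = 0 := pow_eq_zero_iff two_ne_zero |>.mp (by linarith)
  have k₈ : d = 0 := pow_eq_zero_iff two_ne_zero |>.mp (by linarith)
  omega

theorem isRootGram_E₆ : IsRootGram CartanMatrix.E₆ where
  symm a b := CartanMatrix.E₆_isSymm.apply b a
  diag := CartanMatrix.E₆_diag
  pos x hx := by
    by_contra! hq
    simp [CartanMatrix.E₆, dotProduct, mulVec, Fin.sum_univ_succ] at hq
    obtain ⟨h0, h1, h2, h3, h4, h5, -⟩ := eq_zero_of_quadratic_E8_nonpos
      (a := x 0) (b := x 1) (c := x 2) (d := x 3) (e := x 4) (f := x 5) (g := 0) (h := 0)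
      (by linarith)
    exact hx (funext fun i => by fin_cases i <;> assumption)
  conn f hf := by
    have h02 := hf 0 2 (by decide)
    have h23 := hf 2 3 (by decide)
    have h13 := hf 1 3 (by decide)
    have h34 := hf 3 4 (by decide)
    have h45 := hf 4 5 (by decide)
    have h : ∀ a, f a = f 3 := fun a => by fin_cases a <;> simp_all
    intro a b
    rw [h a, h b]

theorem isRootGram_E₇ : IsRootGram CartanMatrix.E₇ where
  symm a b := CartanMatrix.E₇_isSymm.apply b a
  diag := CartanMatrix.E₇_diag
  pos x hx := by
    by_contra! hq
    simp [CartanMatrix.E₇, dotProduct, mulVec, Fin.sum_univ_succ] at hq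
    obtain ⟨h0, h1, h2, h3, h4, h5, h6, -⟩ := eq_zero_of_quadratic_E8_nonpos
      (a := x 0) (b := x 1) (c := x 2) (d := x 3) (e := x 4) (f := x 5) (g := x 6) (h := 0)
      (by linarith)
    exact hx (funext fun i => by fin_cases i <;> assumption)
  conn f hf := by
    have h02 := hf 0 2 (by decide)
    have h23 := hf 2 3 (by decide)
    have h13 := hf 1 3 (by decide)
    have h34 := hf 3 4 (by decide)
    have h45 := hf 4 5 (by decide)
    have h56 := hf 5 6 (by decide)
    have h : ∀ a, f a = f 3 := fun a => by fin_cases a <;> simp_all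
    intro a b
    rw [h a, h b]

theorem isRootGram_E₈ : IsRootGram CartanMatrix.E₈ where
  symm a b := CartanMatrix.E₈_isSymm.apply b a
  diag := CartanMatrix.E₈_diag
  pos x hx := by
    by_contra! hq
    simp [CartanMatrix.E₈, dotProduct, mulVec, Fin.sum_univ_succ] at hq
    obtain ⟨h0, h1, h2, h3, h4, h5, h6, h7⟩ := eq_zero_of_quadratic_E8_nonpos
      (a := x 0) (b := x 1) (c := x 2) (d := x 3) (e := x 4) (f := x 5) (g := x 6) (h := x 7)
      (by linarith)
    exact hx (funext fun i => by fin_cases i <;> assumption)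
  conn f hf := by
    have h02 := hf 0 2 (by decide)
    have h23 := hf 2 3 (by decide)
    have h13 := hf 1 3 (by decide)
    have h34 := hf 3 4 (by decide)
    have h45 := hf 4 5 (by decide)
    have h56 := hf 5 6 (by decide)
    have h67 := hf 6 7 (by decide)
    have h : ∀ a, f a = f 3 := fun a => by fin_cases a <;> simp_all
    intro a b
    rw [h a, h b]

namespace ADE

/-- The Cartan matrix of an `ADE` symbol. -/
def cartan (t : ADE) : Matrix (Fin t.rank) (Fin t.rank) ℤ := -t.gram

theorem isRootGram_cartan : ∀ {t : ADE}, t.ok → IsRootGram t.cartan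
  | A l, h => by
    obtain ⟨k, rfl⟩ : ∃ k, l = k + 1 := ⟨l - 1, by simp only [ok] at h; omega⟩
    exact cast (congrArg IsRootGram (neg_neg (cartanA (k + 1))).symm) (isRootGram_cartanA k)
  | D m, h => by
    obtain ⟨k, rfl⟩ : ∃ k, m = k + 3 := ⟨m - 3, by simp only [ok] at h; omega⟩
    exact cast (congrArg IsRootGram (neg_neg (cartanD (k + 3))).symm) (isRootGram_cartanD k)
  | E6, _ => cast (congrArg IsRootGram (neg_neg CartanMatrix.E₆).symm) isRootGram_E₆
  | E7, _ => cast (congrArg IsRootGram (neg_neg CartanMatrix.E₇).symm) isRootGram_E₇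
  | E8, _ => cast (congrArg IsRootGram (neg_neg CartanMatrix.E₈).symm) isRootGram_E₈

theorem rank_pos {t : ADE} (h : t.ok) : 0 < t.rank := by
  cases t <;> simp only [ok, rank] at * <;> omega

/-- The order of the discriminant group of an `ADE` symbol. -/
def disc : ADE → ℕ
  | A l => l + 1
  | D _ => 4
  | E6 => 3
  | E7 => 2
  | E8 => 1

theorem det_cartan : ∀ {t : ADE}, t.ok → t.cartan.det = t.disc
  | A l, _ => by
    exact (congrArg det (neg_neg (cartanA l))).trans (det_cartanA l)
  | D m, h => by
    obtain ⟨k, rfl⟩ : ∃ k, m = k + 2 := ⟨m - 2, by simp only [ok] at h; omega⟩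
    exact (congrArg det (neg_neg (cartanD (k + 2)))).trans (det_cartanD k)
  | E6, _ => (congrArg det (neg_neg CartanMatrix.E₆)).trans CartanMatrix.E₆_det
  | E7, _ => (congrArg det (neg_neg CartanMatrix.E₇)).trans CartanMatrix.E₇_det
  | E8, _ => (congrArg det (neg_neg CartanMatrix.E₈)).trans CartanMatrix.E₈_det

theorem eq_of_rank_eq_of_disc_eq {s t : ADE} (hs : s.ok) (ht : t.ok) (hr : s.rank = t.rank)
    (hd : s.disc = t.disc) : s = t := by
  cases s <;> cases t <;> simp only [ok, rank, disc, A.injEq, D.injEq, reduceCtorEq] at * <;> omega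

end ADE

theorem bigGram_eq_neg (L : List ADE) :
    bigGram L = -blockDiagonal' fun i => (L.get i).cartan := by
  rw [← blockDiagonal'_neg]
  simp only [bigGram]
  congr 1
  funext i
  exact (neg_neg _).symm

theorem coe_eq_map_get {α : Type*} (L : List α) :
    (L : Multiset α) = (Finset.univ : Finset (Fin L.length)).val.map L.get := by
  rw [Fin.univ_val_map, List.ofFn_get]

theorem perm_iff_exists_equiv {α : Type*} {L₁ L₂ : List α} :
    L₁.Perm L₂ ↔ ∃ σ : Fin L₁.length ≃ Fin L₂.length, ∀ i, L₁.get i = L₂.get (σ i) := by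
  classical
  constructor
  · intro h
    have hcard : ∀ c, Fintype.card {i // L₁.get i = c} = Fintype.card {j // L₂.get j = c} := by
      intro c
      have hc := congrArg (Multiset.count c) (Multiset.coe_eq_coe.mpr h)
      rw [coe_eq_map_get L₁, coe_eq_map_get L₂, Multiset.count_map, Multiset.count_map] at hc
      simp only [Fintype.card_subtype]
      simpa [Finset.card, eq_comm] using hc
    have ε := fun c => Fintype.equivOfCardEq (hcard c)
    exact ⟨Equiv.ofFiberEquiv ε, fun i => (Equiv.ofFiberEquiv_map ε i).symm⟩
  · rintro ⟨σ, hσ⟩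
    rw [← Multiset.coe_eq_coe, coe_eq_map_get L₁, coe_eq_map_get L₂, ← Finset.map_univ_equiv σ,
      Finset.map_val, Multiset.map_map]
    exact Multiset.map_congr rfl fun i _ => hσ i

theorem exists_isometry_of_equiv {ι κ : Type} [Fintype ι] [DecidableEq ι] [Fintype κ]
    [DecidableEq κ] {s : ι → ADE} {t : κ → ADE} (σ : ι ≃ κ) (hσ : ∀ i, s i = t (σ i)) :
    ∃ e : ((Σ i, Fin (s i).rank) → ℤ) ≃ₗ[ℤ] ((Σ j, Fin (t j).rank) → ℤ),
      ∀ x y, e x ⬝ᵥ (blockDiagonal' fun j => (t j).gram) *ᵥ e y =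
        x ⬝ᵥ (blockDiagonal' fun i => (s i).gram) *ᵥ y := by
  obtain rfl : s = t ∘ σ := funext hσ
  let ε : (Σ i, Fin ((t ∘ σ) i).rank) ≃ Σ j, Fin (t j).rank :=
    Equiv.sigmaCongrLeft (β := fun j => Fin (t j).rank) σ
  have hε : (blockDiagonal' fun i => ((t ∘ σ) i).gram) =
      (blockDiagonal' fun j => (t j).gram).submatrix ε ε := by
    ext ⟨i, a⟩ ⟨j, b⟩
    change _ = blockDiagonal' (fun j => (t j).gram) ⟨σ i, a⟩ ⟨σ j, b⟩
    by_cases hij : i = j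
    · subst hij
      rw [blockDiagonal'_apply_eq, blockDiagonal'_apply_eq]
      rfl
    · rw [blockDiagonal'_apply_ne _ _ _ hij,
        blockDiagonal'_apply_ne _ _ _ (σ.injective.ne hij)]
  refine ⟨LinearEquiv.funCongrLeft ℤ ℤ ε.symm, fun x y => ?_⟩
  change (x ∘ ε.symm) ⬝ᵥ _ *ᵥ (y ∘ ε.symm) = _
  rw [hε, submatrix_mulVec_equiv, comp_equiv_symm_dotProduct]

/-- Two root lattices `L(Σ₁)` and `L(Σ₂)` of type `ADE` (root types presented as
lists of `ADE` symbols) are isomorphic as lattices if and only if the root types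
are equal (i.e. the lists agree up to permutation). -/
theorem stmt_5 (L₁ L₂ : List ADE) (h₁ : ∀ t ∈ L₁, t.ok) (h₂ : ∀ t ∈ L₂, t.ok) :
    (∃ e : ((Σ i : Fin L₁.length, Fin (L₁.get i).rank) → ℤ) ≃ₗ[ℤ]
        ((Σ i : Fin L₂.length, Fin (L₂.get i).rank) → ℤ),
      ∀ x y, (e x) ⬝ᵥ (bigGram L₂).mulVec (e y) = x ⬝ᵥ (bigGram L₁).mulVec y) ↔
      L₁.Perm L₂ := by
  rw [perm_iff_exists_equiv]
  constructor
  · rintro ⟨e, he⟩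
    have ok₁ : ∀ i, (L₁.get i).ok := fun i => h₁ _ (L₁.get_mem i)
    have ok₂ : ∀ j, (L₂.get j).ok := fun j => h₂ _ (L₂.get_mem j)
    have (i : Fin L₁.length) : Nonempty (Fin (L₁.get i).rank) := ⟨⟨0, ADE.rank_pos (ok₁ i)⟩⟩
    have (j : Fin L₂.length) : Nonempty (Fin (L₂.get j).rank) := ⟨⟨0, ADE.rank_pos (ok₂ j)⟩⟩
    obtain ⟨σ, hσ⟩ := exists_block_equiv (fun i => ADE.isRootGram_cartan (ok₁ i))
      (fun j => ADE.isRootGram_cartan (ok₂ j)) e fun x y => by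
        simpa [bigGram_eq_neg, neg_mulVec] using he x y
    refine ⟨σ, fun i => ?_⟩
    obtain ⟨e', he'⟩ := hσ i
    refine ADE.eq_of_rank_eq_of_disc_eq (ok₁ i) (ok₂ _) ?_ ?_
    · simpa using e'.finrank_eq
    · have hdet := natAbs_det_eq_of_isometry e' he'
      rwa [ADE.det_cartan (ok₁ i), ADE.det_cartan (ok₂ _), Int.natAbs_natCast,
        Int.natAbs_natCast] at hdet
  · rintro ⟨σ, hσ⟩
    exact exists_isometry_of_equiv σ hσ
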